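/- arXiv:1212.6466 — 2 statements merged into one kernel-verified Lean document; each statement's English description precedes it below -/
import Mathlib

section
/- Let G be a 2-connected graph. If G contains no induced subgraph isomorphic to K_{1,3} (the claw) and no induced subgraph isomorphic to Z_1, then G is Hamiltonian. -/
open SimpleGraph

/-- `G` is 2-connected: at least 3 vertices and deleting any single vertex leaves
a connected graph. -/
def TwoConnected {V : Type*} [Fintype V] (G : SimpleGraph V) : Prop :=
  3 ≤ Fintype.card V ∧ ∀ v : V, (G.induce {w | w ≠ v}).Connected

/-- `c, a, b, d` form an induced claw (`K_{1,3}`) in `G` with center `c` and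
end-vertices `a`, `b`, `d`. -/
def IsInducedClaw {V : Type*} (G : SimpleGraph V) (c a b d : V) : Prop :=
  a ≠ b ∧ a ≠ d ∧ b ≠ d ∧
  G.Adj c a ∧ G.Adj c b ∧ G.Adj c d ∧
  ¬G.Adj a b ∧ ¬G.Adj a d ∧ ¬G.Adj b d

/-- `a₁, a₂, a₃, b₁` form an induced copy of `Z₁` in `G`: triangle `a₁a₂a₃` with
pendant edge `a₁b₁`. -/
def IsInducedZ1 {V : Type*} (G : SimpleGraph V) (a1 a2 a3 b1 : V) : Prop :=
  G.Adj a1 a2 ∧ G.Adj a1 a3 ∧ G.Adj a2 a3 ∧ G.Adj a1 b1 ∧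
  b1 ≠ a2 ∧ b1 ≠ a3 ∧ ¬G.Adj b1 a2 ∧ ¬G.Adj b1 a3

/-- `a₁, a₂, a₃, b₁, c₁` form an induced copy of `Z₂` in `G`: triangle `a₁a₂a₃`
with path `a₁b₁c₁` attached at `a₁`. -/
def IsInducedZ2 {V : Type*} (G : SimpleGraph V) (a1 a2 a3 b1 c1 : V) : Prop :=
  G.Adj a1 a2 ∧ G.Adj a1 a3 ∧ G.Adj a2 a3 ∧ G.Adj a1 b1 ∧ G.Adj b1 c1 ∧
  b1 ≠ a2 ∧ b1 ≠ a3 ∧ c1 ≠ a1 ∧ c1 ≠ a2 ∧ c1 ≠ a3 ∧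
  ¬G.Adj b1 a2 ∧ ¬G.Adj b1 a3 ∧ ¬G.Adj c1 a1 ∧ ¬G.Adj c1 a2 ∧ ¬G.Adj c1 a3

namespace SimpleGraph

variable {V : Type*} {G : SimpleGraph V}

/-- A vertex off a cycle that is adjacent to two consecutive vertices of the cycle can be inserted
between them. -/
theorem Walk.IsCycle.exists_isCycle_length_succ {v x : V} {c : G.Walk v v} (hc : c.IsCycle)
    (hx : x ∉ c.support) (hvx : G.Adj v x) (hxs : G.Adj x c.snd) :
    ∃ c' : G.Walk v v, c'.IsCycle ∧ c'.length = c.length + 1 := by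
  cases c with
  | nil => exact absurd hc Walk.not_isCycle_nil
  | @cons _ w _ h p =>
    rw [Walk.snd_cons] at hxs
    rw [Walk.cons_isCycle_iff] at hc
    have hxp : x ∉ p.support := fun hp => hx (by simp [hp])
    refine ⟨.cons hvx (.cons hxs p), ?_, by simp⟩
    rw [Walk.cons_isCycle_iff, Walk.cons_isPath_iff, Walk.edges_cons, List.mem_cons, not_or]
    refine ⟨⟨hc.1, hxp⟩, ?_, fun he => hxp (p.snd_mem_support_of_mem_edges he)⟩
    rw [Sym2.eq_swap, Sym2.congr_right]
    exact h.ne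

theorem Walk.IsCycle.length_le_card [Fintype V] {v : V} {c : G.Walk v v} (hc : c.IsCycle) :
    c.length ≤ Fintype.card V := by
  have h := hc.isPath_tail.length_lt
  have := Walk.length_tail_add_one hc.not_nil
  omega

/-- A finite graph with a cycle has a longest one. -/
theorem exists_isCycle_forall_length_le [Fintype V] (h : ∃ (v : V) (c : G.Walk v v), c.IsCycle) :
    ∃ (v : V) (c : G.Walk v v), c.IsCycle ∧
      ∀ (w : V) (d : G.Walk w w), d.IsCycle → d.length ≤ c.length := by
  classical
  obtain ⟨v₀, c₀, h₀⟩ := h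
  let P : ℕ → Prop := fun n => ∃ (v : V) (c : G.Walk v v), c.IsCycle ∧ c.length = n
  have hP : P (Nat.findGreatest P (Fintype.card V)) :=
    Nat.findGreatest_spec h₀.length_le_card ⟨v₀, c₀, h₀, rfl⟩
  obtain ⟨v, c, hc, hl⟩ := hP
  refine ⟨v, c, hc, fun w d hd => ?_⟩
  rw [hl]
  exact Nat.le_findGreatest hd.length_le_card ⟨w, d, hd, rfl⟩

end SimpleGraph

namespace TwoConnected

variable {V : Type*} [Fintype V] {G : SimpleGraph V}

theorem exists_ne_ne (h : TwoConnected G) (a b : V) : ∃ w, w ≠ a ∧ w ≠ b := by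
  classical
  have hlt : ({a, b} : Finset V).card < Fintype.card V := Finset.card_le_two.trans_lt h.1
  obtain ⟨w, -, hw⟩ := Finset.exists_mem_notMem_of_card_lt_card
    (s := {a, b}) (t := Finset.univ) (by rwa [Finset.card_univ])
  exact ⟨w, by simpa using hw⟩

theorem exists_walk_avoiding (h : TwoConnected G) {a b w : V} (ha : a ≠ w) (hb : b ≠ w) :
    ∃ p : G.Walk a b, w ∉ p.support := by
  obtain ⟨p⟩ := (h.2 w).preconnected ⟨a, ha⟩ ⟨b, hb⟩
  let f := (Embedding.induce {v | v ≠ w} : G.induce {v | v ≠ w} ↪g G).toHom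
  refine ⟨p.map f, fun hw => ?_⟩
  obtain ⟨y, -, hy⟩ := List.mem_map.mp (Walk.support_map f p ▸ hw : w ∈ p.support.map f)
  exact y.2 hy

theorem preconnected (h : TwoConnected G) : G.Preconnected := fun a b => by
  obtain ⟨w, ha, hb⟩ := h.exists_ne_ne a b
  obtain ⟨p, -⟩ := h.exists_walk_avoiding ha.symm hb.symm
  exact ⟨p⟩

theorem exists_adj_ne (h : TwoConnected G) {x w : V} (hxw : x ≠ w) : ∃ a, G.Adj x a ∧ a ≠ w := by
  obtain ⟨y, hyx, hyw⟩ := h.exists_ne_ne x w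
  obtain ⟨p, hp⟩ := h.exists_walk_avoiding hxw hyw
  cases p with
  | nil => exact absurd rfl hyx
  | @cons _ a _ hxa q =>
    refine ⟨a, hxa, ?_⟩
    rintro rfl
    exact hp (by simp)

theorem exists_isCycle (h : TwoConnected G) : ∃ (v : V) (c : G.Walk v v), c.IsCycle := by
  classical
  obtain ⟨x⟩ : Nonempty V := Fintype.card_pos_iff.mp (by have := h.1; omega)
  obtain ⟨w, hwx, -⟩ := h.exists_ne_ne x x
  obtain ⟨a, hxa, -⟩ := h.exists_adj_ne hwx.symm
  obtain ⟨b, hxb, hba⟩ := h.exists_adj_ne hxa.ne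
  obtain ⟨p, hp⟩ := h.exists_walk_avoiding hxa.ne' hxb.ne'
  have hq : x ∉ p.bypass.support := fun hx => hp (p.support_bypass_subset_support hx)
  refine ⟨x, .cons hxa (p.bypass.concat hxb.symm), ?_⟩
  rw [Walk.cons_isCycle_iff, Walk.concat_isPath_iff, Walk.edges_concat, List.concat_eq_append,
    List.mem_append, List.mem_singleton, not_or]
  refine ⟨⟨p.bypass_isPath, hq⟩, fun he => hq (Walk.fst_mem_support_of_mem_edges _ he), ?_⟩
  rw [Sym2.eq_swap, Sym2.congr_left]
  exact hba.symm

end TwoConnected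

/-- **Goodman–Hedetniemi theorem.** Every 2-connected `{K_{1,3}, Z₁}`-free graph
is Hamiltonian. -/
theorem goodman_hedetniemi {V : Type*} [Fintype V] [DecidableEq V]
    (G : SimpleGraph V)
    (h2 : TwoConnected G)
    (hclaw : ∀ c a b d : V, ¬IsInducedClaw G c a b d)
    (hZ1 : ∀ a1 a2 a3 b1 : V, ¬IsInducedZ1 G a1 a2 a3 b1) :
    G.IsHamiltonian := by
  obtain ⟨u, c, hc, hmax⟩ := exists_isCycle_forall_length_le h2.exists_isCycle
  intro _
  refine ⟨u, c, Walk.isHamiltonianCycle_isCycle_and_isHamiltonian_tail.mpr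
    ⟨hc, hc.isPath_tail.isHamiltonian_iff.mpr fun y => ?_⟩⟩
  suffices hy : y ∈ c.support by
    rw [Walk.support_tail_of_not_nil _ hc.not_nil]
    rcases c.mem_support_iff.mp hy with rfl | hy
    · exact Walk.end_mem_tail_support hc.not_nil
    · exact hy
  by_contra hy
  obtain ⟨p⟩ := h2.preconnected u y
  obtain ⟨⟨⟨v, x⟩, hvx⟩, -, hv, hx⟩ :=
    p.exists_boundary_dart {w | w ∈ c.support} c.start_mem_support hy
  have hvc : v ∈ c.support := hv
  have hxc : x ∉ c.support := hx
  have hr : (c.rotate v hvc).IsCycle := hc.rotate hvc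
  have hxr : x ∉ (c.rotate v hvc).support := by
    rwa [Walk.mem_support_rotate_iff]
  have hlen : (c.rotate v hvc).length = c.length := Walk.length_rotate c v hvc
  generalize c.rotate v hvc = r at hr hxr hlen
  have hsnd : ¬G.Adj x r.snd := fun hxs => by
    obtain ⟨d, hd, hdl⟩ := hr.exists_isCycle_length_succ hxr hvx hxs
    have := hmax v d hd
    omega
  have hpen : ¬G.Adj x r.penultimate := fun hxs => by
    rw [← Walk.snd_reverse] at hxs
    obtain ⟨d, hd, hdl⟩ := hr.reverse.exists_isCycle_length_succ (by simpa using hxr) hvx hxs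
    have := hmax v d hd
    rw [Walk.length_reverse] at hdl
    omega
  have hvs : G.Adj v r.snd := r.adj_snd hr.not_nil
  have hvp : G.Adj v r.penultimate := (r.adj_penultimate hr.not_nil).symm
  have hsx : x ≠ r.snd := fun h => hxr (h ▸ r.getVert_mem_support 1)
  have hpx : x ≠ r.penultimate := fun h => hxr (h ▸ r.getVert_mem_support _)
  by_cases hsp : G.Adj r.snd r.penultimate
  · exact hZ1 v r.snd r.penultimate x ⟨hvs, hvp, hsp, hvx, hsx, hpx, hsnd, hpen⟩
  · exact hclaw v x r.snd r.penultimate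
      ⟨hsx, hpx, hr.snd_ne_penultimate, hvx, hvs, hvp, hsnd, hpen, hsp⟩
end

section
/- Let G be a 2-connected 2-heavy graph on n vertices. If for every pair of vertices u, v with distance 2 in G, either max{deg(u), deg(v)} ≥ n/2 or |N(u) ∩ N(v)| ≥ 2, then G is Hamiltonian. -/
open SimpleGraph

/-- A vertex is heavy if its degree is at least `n/2`. -/
def Heavy {V : Type*} [Fintype V] (G : SimpleGraph V) [DecidableRel G.Adj] (v : V) : Prop :=
  Fintype.card V ≤ 2 * G.degree v

/-- `G` is 1-heavy: every induced claw has at least one heavy end-vertex. -/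
def OneHeavy {V : Type*} [Fintype V] (G : SimpleGraph V) [DecidableRel G.Adj] : Prop :=
  ∀ c a b d : V, IsInducedClaw G c a b d → Heavy G a ∨ Heavy G b ∨ Heavy G d

/-- `G` is 2-heavy: every induced claw has at least two heavy end-vertices. -/
def TwoHeavy {V : Type*} [Fintype V] (G : SimpleGraph V) [DecidableRel G.Adj] : Prop :=
  ∀ c a b d : V, IsInducedClaw G c a b d →
    (Heavy G a ∧ Heavy G b) ∨ (Heavy G a ∧ Heavy G d) ∨ (Heavy G b ∧ Heavy G d)

/-- `G` is o-heavy: every induced claw has two end-vertices with degree sum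
at least `n`. -/
def OHeavy {V : Type*} [Fintype V] (G : SimpleGraph V) [DecidableRel G.Adj] : Prop :=
  ∀ c a b d : V, IsInducedClaw G c a b d →
    Fintype.card V ≤ G.degree a + G.degree b ∨
    Fintype.card V ≤ G.degree a + G.degree d ∨
    Fintype.card V ≤ G.degree b + G.degree d

/-- The pair `u, v` satisfies Fan's condition (`max{d(u),d(v)} ≥ n/2`) or Shi's
condition (`|N(u) ∩ N(v)| ≥ 2`). -/
def FanOrShi {V : Type*} [Fintype V] [DecidableEq V]
    (G : SimpleGraph V) [DecidableRel G.Adj] (u v : V) : Prop :=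
  Fintype.card V ≤ 2 * G.degree u ∨ Fintype.card V ≤ 2 * G.degree v ∨
  2 ≤ (G.neighborFinset u ∩ G.neighborFinset v).card

/-- `PathOn A a b S`: the graph `A` has a path from `a` to `b` whose vertex set is `S`. -/
inductive PathOn {V : Type*} [DecidableEq V] (A : SimpleGraph V) : V → V → Finset V → Prop
  | single (a : V) : PathOn A a a {a}
  | cons {a b c : V} {S : Finset V} (h : A.Adj a b) (p : PathOn A b c S) (ha : a ∉ S) :
      PathOn A a c (insert a S)

/-- `CycleOn A S`: the graph `A` has a cycle whose vertex set is `S`. -/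
def CycleOn {V : Type*} [DecidableEq V] (A : SimpleGraph V) (S : Finset V) : Prop :=
  3 ≤ S.card ∧ ∃ a b, PathOn A a b S ∧ A.Adj b a

namespace PathOn

variable {V : Type*} [DecidableEq V] {A B : SimpleGraph V} {a b c d u v x : V} {S T : Finset V}

lemma congr_set (p : PathOn A a b S) (h : S = T) : PathOn A a b T := h ▸ p

lemma left_mem (p : PathOn A a b S) : a ∈ S := by
  cases p <;> simp

lemma right_mem (p : PathOn A a b S) : b ∈ S := by
  induction p with
  | single a => simp
  | cons h p ha ih => exact Finset.mem_insert_of_mem ih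

lemma mono (hAB : A ≤ B) (p : PathOn A a b S) : PathOn B a b S := by
  induction p with
  | single a => exact single a
  | cons h p ha ih => exact cons (hAB h) ih ha

lemma append (p : PathOn A a b S) (h : A.Adj b c) (q : PathOn A c d T)
    (hd : ∀ x ∈ S, x ∉ T) : PathOn A a d (S ∪ T) := by
  induction p with
  | single a =>
    exact (cons h q (hd a (by simp))).congr_set (by simp)
  | cons h' p ha ih =>
    exact (cons h' (ih h (by grind)) (by grind)).congr_set (by simp)

lemma symm (p : PathOn A a b S) : PathOn A b a S := by
  induction p with
  | single a => exact single a
  | @cons a b c S h p ha ih =>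
    exact (ih.append h.symm (single a) (by grind)).congr_set (by grind)

lemma eq_singleton (p : PathOn A a a S) : S = {a} := by
  cases p with
  | single => rfl
  | cons h p ha => exact absurd p.right_mem ha

lemma uncons (p : PathOn A a b S) (hab : a ≠ b) :
    ∃ c T, A.Adj a c ∧ PathOn A c b T ∧ a ∉ T ∧ S = insert a T := by
  cases p with
  | single => exact absurd rfl hab
  | cons h p ha => exact ⟨_, _, h, p, ha, rfl⟩

lemma split (p : PathOn A a b S) (hc : c ∈ S) (hca : c ≠ a) :
    ∃ S₁ S₂ d, PathOn A a d S₁ ∧ A.Adj d c ∧ PathOn A c b S₂ ∧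
      (∀ x ∈ S₁, x ∉ S₂) ∧ S = S₁ ∪ S₂ := by
  induction p with
  | single a => simp_all
  | @cons a a' b S h p ha ih =>
    by_cases hca' : c = a'
    · subst hca'
      exact ⟨{a}, S, a, single a, h, p, by grind, by grind⟩
    · obtain ⟨S₁, S₂, d, p₁, hd, p₂, hdis, rfl⟩ := ih (by grind) hca'
      exact ⟨insert a S₁, S₂, d, cons h p₁ (by grind), hd, p₂, by grind, by grind⟩

/-- The initial segment of a path up to its first vertex in `S`. -/
lemma exists_first_hit (p : PathOn A a b T) (ha : a ∉ S) (hb : b ∈ S) :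
    ∃ T' c d, PathOn A a c T' ∧ T' ⊆ T ∧ (∀ x ∈ T', x ∉ S) ∧ A.Adj c d ∧ d ∈ S ∧ d ∈ T := by
  induction p with
  | single a => exact absurd hb ha
  | @cons a a' b T h p haT ih =>
    by_cases ha' : a' ∈ S
    · exact ⟨{a}, a, a', single a, by simp, by simpa, h, ha', by simp [p.left_mem]⟩
    · obtain ⟨T', c, d, p', hT, hS, hcd, hd, hdT⟩ := ih ha' hb
      exact ⟨insert a T', c, d, cons h p' (fun h' => haT (hT h')),
        Finset.insert_subset_insert _ hT, by grind, hcd, hd, by grind⟩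

lemma of_walk {u v : V} (w : A.Walk u v) :
    ∃ T, PathOn A u v T ∧ ∀ x ∈ T, x ∈ w.support := by
  induction w with
  | nil => exact ⟨_, single _, by simp⟩
  | @cons u x v h w ih =>
    obtain ⟨T, p, hT⟩ := ih
    by_cases hu : u ∈ T
    · by_cases hux : u = x
      · exact absurd hux h.ne
      · obtain ⟨S₁, S₂, d, -, -, p₂, -, rfl⟩ := p.split hu hux
        exact ⟨S₂, p₂, by grind [Walk.support_cons]⟩
    · exact ⟨_, cons h p hu, by grind [Walk.support_cons]⟩

lemma exists_walk (p : PathOn A a b S) :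
    ∃ w : A.Walk a b, w.IsPath ∧ ∀ x, x ∈ w.support ↔ x ∈ S := by
  induction p with
  | single a => exact ⟨Walk.nil, by simp, by simp⟩
  | cons h p ha ih =>
    obtain ⟨w, hw, hS⟩ := ih
    exact ⟨Walk.cons h w, by simp [Walk.cons_isPath_iff, hw, hS, ha], by simp [hS]⟩

lemma exists_of_isClique (hA : ∀ x ∈ S, ∀ y ∈ S, x ≠ y → A.Adj x y) (ha : a ∈ S) :
    ∃ b, PathOn A a b S := by
  induction S using Finset.strongInduction generalizing a with
  | H S ih =>
    by_cases hS : S.erase a = ∅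
    · exact ⟨a, (single a).congr_set (by rw [← Finset.insert_erase ha, hS]; simp)⟩
    · obtain ⟨c, hc⟩ := Finset.nonempty_iff_ne_empty.mpr hS
      obtain ⟨b, p⟩ := ih (S.erase a) (Finset.erase_ssubset ha)
        (by grind) hc
      exact ⟨b, (cons (hA a ha c (by grind) (by grind)) p (by simp)).congr_set (by grind)⟩

/-- If no consecutive vertices `y, z` on a path satisfy `Q y` and `P z`, then the numbers of
vertices with `P` and with `Q` are jointly bounded. -/
lemma card_filter_add_card_filter_le (P Q : V → Prop) [DecidablePred P] [DecidablePred Q]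
    (p : PathOn A a b S) (ha : ¬ P a) (hb : ¬ Q b)
    (hsplit : ∀ S₁ S₂ y z, PathOn A a y S₁ → A.Adj y z → PathOn A z b S₂ →
      (∀ x ∈ S₁, x ∉ S₂) → S = S₁ ∪ S₂ → ¬ (Q y ∧ P z)) :
    (S.filter P).card + (S.filter Q).card + 1 ≤ S.card := by
  suffices h : (S.filter P).card + (S.filter Q).card + 1 ≤
      S.card + (if P a then 1 else 0) + (if Q b then 1 else 0) by simpa [ha, hb] using h
  clear ha hb
  induction p with
  | single a => by_cases h1 : P a <;> by_cases h2 : Q a <;> simp [Finset.filter_singleton, h1, h2]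
  | @cons a a' b S h p ha ih =>
    have h1 := ih (fun S₁ S₂ y z p₁ hyz p₂ hd hS => hsplit (insert a S₁) S₂ y z
      (cons h p₁ (by grind)) hyz p₂ (by grind) (by grind))
    have h2 := hsplit {a} S a a' (single a) h p (by grind) (by grind)
    rw [Finset.filter_insert, Finset.filter_insert, Finset.card_insert_of_notMem ha]
    have h3 : (insert a (S.filter P)).card ≤ (S.filter P).card + 1 := Finset.card_insert_le _ _
    have h4 : (insert a (S.filter Q)).card ≤ (S.filter Q).card + 1 := Finset.card_insert_le _ _
    split_ifs at * <;> first | omega | (exfalso; tauto)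

end PathOn

namespace CycleOn

variable {V : Type*} [DecidableEq V] {A B : SimpleGraph V} {u v x : V} {S : Finset V}

lemma mono (hAB : A ≤ B) (h : CycleOn A S) : CycleOn B S := by
  obtain ⟨hS, a, b, p, hba⟩ := h
  exact ⟨hS, a, b, p.mono hAB, hAB hba⟩

lemma of_paths {a b c d : V} {S₁ S₂ : Finset V} (p : PathOn A a b S₁) (h : A.Adj b c)
    (q : PathOn A c d S₂) (hda : A.Adj d a) (hd : ∀ x ∈ S₁, x ∉ S₂) (hS : 3 ≤ (S₁ ∪ S₂).card) :
    CycleOn A (S₁ ∪ S₂) :=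
  ⟨hS, a, d, p.append h q hd, hda⟩

/-- A cycle can be opened at any of its vertices. -/
lemma exists_path_erase (h : CycleOn A S) (hx : x ∈ S) :
    ∃ p q T, PathOn A p q T ∧ A.Adj x p ∧ A.Adj x q ∧ p ≠ q ∧ x ∉ T ∧ S = insert x T := by
  obtain ⟨hS, a, b, p, hba⟩ := h
  obtain ⟨q, p', hqx⟩ : ∃ q, PathOn A x q S ∧ A.Adj q x := by
    by_cases hxa : x = a
    · exact ⟨b, hxa ▸ p, hxa ▸ hba⟩
    · obtain ⟨S₁, S₂, d, p₁, hd, p₂, hdis, rfl⟩ := p.split hx hxa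
      exact ⟨d, (p₂.append hba p₁ (by grind)).congr_set (Finset.union_comm _ _), hd⟩
  obtain ⟨c, T, hc, r, hxT, rfl⟩ := p'.uncons hqx.ne'
  refine ⟨c, q, T, r, hc, hqx.symm, ?_, hxT, rfl⟩
  rintro rfl
  rw [r.eq_singleton] at hS
  exact absurd (hS.trans (Finset.card_insert_le _ _)) (by simp)

lemma isHamiltonian [Fintype V] (h : CycleOn A Finset.univ) : A.IsHamiltonian := by
  intro _
  obtain ⟨hc, a, b, p, hba⟩ := h
  obtain ⟨w, hw, hS⟩ := p.exists_walk
  have hham : w.IsHamiltonian := hw.isHamiltonian_of_mem (by simp [hS])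
  refine ⟨b, Walk.cons hba w, ?_⟩
  rw [Walk.isHamiltonianCycle_iff_isCycle_and_support_count_tail_eq_one]
  refine ⟨(Walk.cons_isCycle_iff _ _).mpr ⟨hw, fun he => ?_⟩, hham⟩
  have h1 := hw.length_eq_one_of_mem_edges (Sym2.eq_swap ▸ he)
  have h2 := hham.length_eq
  rw [Finset.card_univ] at hc
  omega

end CycleOn

section HeavyPairs

variable {V : Type*} [DecidableEq V] {A G : SimpleGraph V} {a b u v : V} {S : Finset V}

lemma PathOn.deleteEdge (p : PathOn A a b S) (u v : V) :
    PathOn (A.deleteEdges {s(u, v)}) a b S ∨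
    ∃ S₁ S₂ y z, PathOn (A.deleteEdges {s(u, v)}) a y S₁ ∧
      PathOn (A.deleteEdges {s(u, v)}) z b S₂ ∧ (∀ x ∈ S₁, x ∉ S₂) ∧ S = S₁ ∪ S₂ ∧
      s(y, z) = s(u, v) := by
  induction p with
  | single a => exact Or.inl (.single a)
  | @cons a a' b S h p ha ih =>
    by_cases he : s(a, a') = s(u, v)
    · rcases ih with ih | ⟨S₁, S₂, y, z, p₁, p₂, hd, rfl, hyz⟩
      · exact Or.inr ⟨{a}, S, a, a', .single a, ih, by simpa, by simp, he⟩
      · have h1 := p₁.right_mem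
        have h2 := p₂.left_mem
        have : a ∈ s(y, z) := by rw [hyz, ← he]; simp
        exfalso
        rcases Sym2.mem_iff.mp this with rfl | rfl <;> simp_all
    · have h' : (A.deleteEdges {s(u, v)}).Adj a a' := by simp [deleteEdges_adj, h, -Sym2.eq, he]
      rcases ih with ih | ⟨S₁, S₂, y, z, p₁, p₂, hd, rfl, hyz⟩
      · exact Or.inl (.cons h' ih ha)
      · exact Or.inr ⟨insert a S₁, S₂, y, z, .cons h' p₁ (by grind), p₂, by grind, by grind, hyz⟩

lemma CycleOn.deleteEdge (h : CycleOn A S) (u v : V) :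
    CycleOn (A.deleteEdges {s(u, v)}) S ∨ PathOn (A.deleteEdges {s(u, v)}) u v S := by
  obtain ⟨hS, a, b, p, hba⟩ := h
  rcases p.deleteEdge u v with p' | ⟨S₁, S₂, y, z, p₁, p₂, hd, rfl, hyz⟩
  · by_cases he : s(b, a) = s(u, v)
    · rcases Sym2.eq_iff.mp he with ⟨rfl, rfl⟩ | ⟨rfl, rfl⟩
      · exact Or.inr p'.symm
      · exact Or.inr p'
    · exact Or.inl ⟨hS, a, b, p', by simp [deleteEdges_adj, hba, -Sym2.eq, he]⟩
  · have he : s(b, a) ≠ s(u, v) := by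
      rw [← hyz]
      intro he
      rcases Sym2.eq_iff.mp he with ⟨rfl, rfl⟩ | ⟨rfl, rfl⟩
      · exact hd _ p₁.left_mem p₂.left_mem
      · rw [p₁.eq_singleton, p₂.eq_singleton] at hS
        exact absurd (hS.trans (Finset.card_union_le _ _)) (by simp)
    have p := (p₂.append (by simp [deleteEdges_adj, hba, -Sym2.eq, he]) p₁
      (by grind)).congr_set (Finset.union_comm _ _)
    rcases Sym2.eq_iff.mp hyz with ⟨rfl, rfl⟩ | ⟨rfl, rfl⟩
    · exact Or.inr p.symm
    · exact Or.inr p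

/-- Ore-type closing of a path whose ends have large degree sum. -/
lemma PathOn.exists_cycleOn [Fintype V] [DecidableRel A.Adj] (p : PathOn A u v S)
    (hS : 3 ≤ S.card) (hdeg : Fintype.card V ≤ A.degree u + A.degree v) :
    ∃ T, S ⊆ T ∧ CycleOn A T := by
  by_cases hout : ∃ w ∉ S, A.Adj u w ∧ A.Adj v w
  · obtain ⟨w, hw, huw, hvw⟩ := hout
    exact ⟨insert w S, Finset.subset_insert _ _,
      hS.trans (Finset.card_le_card (Finset.subset_insert _ _)), w, v,
      .cons huw.symm p hw, hvw⟩
  by_cases hin : ∃ S₁ S₂ y z, PathOn A u y S₁ ∧ A.Adj y z ∧ PathOn A z v S₂ ∧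
      (∀ x ∈ S₁, x ∉ S₂) ∧ S = S₁ ∪ S₂ ∧ A.Adj v y ∧ A.Adj u z
  · obtain ⟨S₁, S₂, y, z, p₁, -, p₂, hd, rfl, hvy, huz⟩ := hin
    exact ⟨_, subset_rfl, .of_paths p₁ hvy.symm p₂.symm huz.symm hd hS⟩
  exfalso
  have h1 := p.card_filter_add_card_filter_le (A.Adj u) (A.Adj v) A.irrefl A.irrefl
    (fun S₁ S₂ y z p₁ hyz p₂ hd hST hQ => hin ⟨S₁, S₂, y, z, p₁, hyz, p₂, hd, hST, hQ⟩)
  have hsplit (w : V) :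
      A.degree w = (S.filter (A.Adj w)).card + (Sᶜ.filter (A.Adj w)).card := by
    rw [← card_neighborFinset_eq_degree, neighborFinset_eq_filter,
      ← Finset.card_union_of_disjoint]
    · rw [← Finset.filter_union, Finset.union_compl]
    · exact Finset.disjoint_filter_filter disjoint_compl_right
  have h2 : (Sᶜ.filter (A.Adj u)).card + (Sᶜ.filter (A.Adj v)).card ≤ Sᶜ.card := by
    rw [← Finset.card_union_of_disjoint]
    · exact Finset.card_le_card (by grind)
    · rw [Finset.disjoint_left]
      intro w hw hw'
      simp only [Finset.mem_filter, Finset.mem_compl] at hw hw'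
      exact hout ⟨w, hw.1, hw.2, hw'.2⟩
  have h3 := Finset.card_add_card_compl S
  have h4 := hsplit u
  have h5 := hsplit v
  omega

/-- If every edge of `H` outside `G` joins vertices with degree sum at least `n`, then the vertices
of any cycle of `H` lie on a cycle of `G`. -/
lemma CycleOn.exists_of_degree_add [Fintype V] [DecidableRel G.Adj] {H : SimpleGraph V}
    (hGH : G ≤ H) (hdeg : ∀ u v, H.Adj u v → ¬ G.Adj u v →
      Fintype.card V ≤ G.degree u + G.degree v) (hS : CycleOn H S) :
    ∃ T, S ⊆ T ∧ CycleOn G T := by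
  induction H using WellFoundedLT.induction generalizing S with
  | ind H ih =>
    by_cases hHG : H ≤ G
    · exact ⟨S, subset_rfl, hS.mono hHG⟩
    obtain ⟨u, v, huv, hG⟩ : ∃ u v, H.Adj u v ∧ ¬ G.Adj u v := by
      by_contra! hcon
      exact hHG fun u v => hcon u v
    set H' := H.deleteEdges {s(u, v)} with hH'
    have hle : H' ≤ H := deleteEdges_le _
    have hlt : H' < H := lt_of_le_not_ge hle fun hge => by
      have := hge huv
      simp [hH', deleteEdges_adj] at this
    have hGH' : G ≤ H' := fun x y hxy => by
      refine (deleteEdges_adj).mpr ⟨hGH hxy, fun he => ?_⟩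
      rw [Set.mem_singleton_iff, Sym2.eq_iff] at he
      rcases he with ⟨rfl, rfl⟩ | ⟨rfl, rfl⟩
      · exact hG hxy
      · exact hG hxy.symm
    obtain ⟨T, hST, hT⟩ : ∃ T, S ⊆ T ∧ CycleOn H' T := by
      rcases hS.deleteEdge u v with h | p
      · exact ⟨S, subset_rfl, h⟩
      · classical
        exact p.exists_cycleOn hS.1 ((hdeg u v huv hG).trans
          (add_le_add (degree_le_of_le hGH') (degree_le_of_le hGH')))
    obtain ⟨T', hT', hG'⟩ := ih H' hlt hGH' (fun x y hxy => hdeg x y (hle hxy)) hT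
    exact ⟨T', hST.trans hT', hG'⟩

end HeavyPairs

section TwoConnected

variable {V : Type*} [DecidableEq V] [Fintype V] {G : SimpleGraph V} {a b v : V}

lemma TwoConnected.exists_pathOn (h : TwoConnected G) (ha : a ≠ v) (hb : b ≠ v) :
    ∃ T, PathOn G a b T ∧ v ∉ T := by
  obtain ⟨w⟩ := (h.2 v).preconnected ⟨a, ha⟩ ⟨b, hb⟩
  obtain ⟨T, p, hT⟩ := PathOn.of_walk (w.map (Embedding.induce _).toHom)
  refine ⟨T, p, fun hv => ?_⟩
  have := hT v hv
  rw [Walk.support_map, List.mem_map] at this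
  obtain ⟨x, -, hx⟩ := this
  exact x.2 hx

lemma TwoConnected.exists_adj_ne_s4 (h : TwoConnected G) (hab : a ≠ b) : ∃ w, G.Adj a w ∧ w ≠ b := by
  obtain ⟨c, hc⟩ : ∃ c, c ∉ ({a, b} : Finset V) := by
    by_contra! hcon
    have := Finset.card_le_card (fun x _ => hcon x : (Finset.univ : Finset V) ⊆ {a, b})
    have h2 := Finset.card_le_two (a := a) (b := b)
    rw [Finset.card_univ] at this
    have := h.1
    omega
  obtain ⟨T, p, hb⟩ := h.exists_pathOn hab (show c ≠ b by grind)
  obtain ⟨w, T', hw, p', -, rfl⟩ := p.uncons (by grind)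
  exact ⟨w, hw, by have := p'.left_mem; grind⟩

/-- Every edge of a supergraph of a 2-connected graph lies on a cycle. -/
lemma TwoConnected.exists_cycleOn (h : TwoConnected G) {H : SimpleGraph V} (hGH : G ≤ H)
    (hab : H.Adj a b) : ∃ S, a ∈ S ∧ b ∈ S ∧ CycleOn H S := by
  obtain ⟨w, haw, hwb⟩ := h.exists_adj_ne_s4 hab.ne
  obtain ⟨T, p, ha⟩ := h.exists_pathOn haw.ne' hab.ne'
  have h1 := p.left_mem
  have h2 := p.right_mem
  refine ⟨insert a T, by simp, by simp [h2], ?_, a, b, .cons (hGH haw) (p.mono hGH) ha, hab.symm⟩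
  rw [Finset.card_insert_of_notMem ha]
  have := Finset.card_le_card (show {w, b} ⊆ T by grind)
  rw [Finset.card_pair hwb] at this
  omega

/-- In a 2-connected graph, outside any proper vertex subset `S` with at least two elements there
is a path whose ends have distinct neighbours in `S`. -/
lemma TwoConnected.exists_pathOn_compl (h : TwoConnected G) {S : Finset V} (hS : 2 ≤ S.card)
    (hne : S ≠ Finset.univ) :
    ∃ x₁ x₂ u₁ u₂ T, x₁ ∈ S ∧ x₂ ∈ S ∧ x₁ ≠ x₂ ∧ G.Adj u₁ x₁ ∧ G.Adj u₂ x₂ ∧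
      PathOn G u₁ u₂ T ∧ ∀ x ∈ T, x ∉ S := by
  obtain ⟨u, hu⟩ : ∃ u, u ∉ S := by
    by_contra! hcon
    exact hne (Finset.eq_univ_iff_forall.mpr hcon)
  obtain ⟨s, hs, t, ht, hst⟩ := Finset.one_lt_card.mp hS
  obtain ⟨T₀, p₀, -⟩ := h.exists_pathOn (v := t) (a := u) (b := s) (by grind) hst
  obtain ⟨_, u₁, x₁, p₁, -, hT₁, hux₁, hx₁, -⟩ := p₀.exists_first_hit hu hs
  have hu₁ : u₁ ∉ S := hT₁ _ p₁.right_mem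
  obtain ⟨y, hy, hyx⟩ := Finset.exists_mem_ne hS x₁
  obtain ⟨T₂, p₂, hT₂⟩ := h.exists_pathOn hux₁.ne hyx
  obtain ⟨T, u₂, x₂, p, -, hT, hux₂, hx₂, hx₂T⟩ := p₂.exists_first_hit hu₁ hy
  exact ⟨x₁, x₂, u₁, u₂, T, hx₁, hx₂, by grind, hux₁, hux₂, p, hT⟩

end TwoConnected

/-- The graph obtained from `G` by making its heavy vertices a clique. -/
def heavyCompletion {V : Type*} [Fintype V] (G : SimpleGraph V) [DecidableRel G.Adj] :
    SimpleGraph V where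
  Adj u v := u ≠ v ∧ (G.Adj u v ∨ Heavy G u ∧ Heavy G v)
  symm := ⟨fun _ _ h => ⟨h.1.symm, h.2.imp (·.symm) (·.symm)⟩⟩
  loopless := ⟨fun _ h => h.1 rfl⟩

lemma le_heavyCompletion {V : Type*} [Fintype V] {G : SimpleGraph V} [DecidableRel G.Adj] :
    G ≤ heavyCompletion G := fun _ _ h => ⟨h.ne, Or.inl h⟩

section HeavyCompletion

variable {V : Type*} [DecidableEq V] [Fintype V] {G : SimpleGraph V} [DecidableRel G.Adj]
  {p q u x : V} {S T : Finset V}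

/-- No cycle of the heavy completion has a vertex set properly containing `S`. -/
def IsCycleMaximal (G : SimpleGraph V) [DecidableRel G.Adj] (S : Finset V) : Prop :=
  ∀ T, S ⊆ T → CycleOn (heavyCompletion G) T → T ⊆ S

lemma IsCycleMaximal.not_adj (hmax : IsCycleMaximal G (insert x T)) (P : PathOn G p q T)
    (hxT : x ∉ T) (huT : u ∉ T) (hxq : G.Adj x q) (hxu : G.Adj x u) :
    ¬ (heavyCompletion G).Adj u p := by
  intro hup
  have hxu' := hxu.ne
  have hcard : 3 ≤ (insert x (insert u T)).card := by
    rw [Finset.card_insert_of_notMem (by grind), Finset.card_insert_of_notMem huT]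
    have := Finset.card_pos.mpr ⟨p, P.left_mem⟩
    omega
  have hle := le_heavyCompletion (G := G)
  have := hmax (insert x (insert u T)) (by grind) ⟨hcard, x, q,
    .cons (hle hxu) (.cons hup (P.mono hle) huT) (by grind), hle hxq.symm⟩
  have := this (show u ∈ insert x (insert u T) by simp)
  grind

lemma IsCycleMaximal.adj (hmax : IsCycleMaximal G (insert x T)) (hheavy : TwoHeavy G)
    (P : PathOn G p q T) (hxT : x ∉ T) (huT : u ∉ T) (hxp : G.Adj x p) (hxq : G.Adj x q)
    (hpq : p ≠ q) (hxu : G.Adj x u) : (heavyCompletion G).Adj p q := by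
  by_contra hcon
  have h1 := hmax.not_adj P hxT huT hxq hxu
  have h2 := hmax.not_adj P.symm hxT huT hxp hxu
  have hup : u ≠ p := by rintro rfl; exact huT P.left_mem
  have huq : u ≠ q := by rintro rfl; exact huT P.right_mem
  have hle := le_heavyCompletion (G := G)
  rcases hheavy x u p q ⟨hup, huq, hpq, hxu, hxp, hxq, fun h => h1 (hle h), fun h => h2 (hle h),
    fun h => hcon (hle h)⟩ with h | h | h
  · exact h1 ⟨hup, Or.inr h⟩
  · exact h2 ⟨huq, Or.inr h⟩
  · exact hcon ⟨hpq, Or.inr h⟩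

/-- The cycle neighbours of a vertex attached to a light vertex off the cycle are heavy. -/
lemma IsCycleMaximal.heavy (hmax : IsCycleMaximal G (insert x T)) (hheavy : TwoHeavy G)
    (h : ∀ u v : V, G.dist u v = 2 → FanOrShi G u v)
    (P : PathOn G p q T) (hxT : x ∉ T) (huT : u ∉ T) (hxp : G.Adj x p) (hxq : G.Adj x q)
    (hxu : G.Adj x u) (hu : ¬ Heavy G u) : Heavy G p := by
  by_contra hp
  have hle := le_heavyCompletion (G := G)
  have hup : u ≠ p := by rintro rfl; exact huT P.left_mem
  have hxu' := hxu.ne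
  have hnadj : ¬ G.Adj u p := fun h' => hmax.not_adj P hxT huT hxq hxu (hle h')
  have hdist : G.dist u p = 2 := by
    have h1 : G.dist u p ≤ 2 := dist_le (.cons hxu.symm (.cons hxp .nil))
    have h2 : 1 < G.dist u p :=
      Reachable.one_lt_dist_of_ne_of_not_adj ⟨.cons hxu.symm (.cons hxp .nil)⟩ hup hnadj
    omega
  rcases h u p hdist with h' | h' | hcard
  · exact hu h'
  · exact hp h'
  obtain ⟨w, hw, hwx⟩ := Finset.exists_mem_ne hcard x
  rw [Finset.mem_inter, mem_neighborFinset, mem_neighborFinset] at hw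
  obtain ⟨huw, hpw⟩ := hw
  have hwu := huw.ne
  have hpos := Finset.card_pos.mpr ⟨p, P.left_mem⟩
  have hcontra : ∀ S b, PathOn (heavyCompletion G) x b S → (heavyCompletion G).Adj b x →
      u ∈ S → insert x T ⊆ S → False := by
    intro S b Q hbx huS hTS
    have hcard' : 3 ≤ (insert x (insert u T)).card := by
      rw [Finset.card_insert_of_notMem (by grind), Finset.card_insert_of_notMem huT]
      omega
    have := hmax S hTS ⟨hcard'.trans (Finset.card_le_card (by grind)), x, b, Q, hbx⟩ huS
    grind
  by_cases hwT : w ∈ T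
  · have hwp := hpw.ne'
    obtain ⟨S₁, S₂, d, P₁, hdw, P₂, hd, rfl⟩ := P.split hwT hwp
    have h1 := P₁.right_mem
    have h2 := P₂.left_mem
    by_cases hwq : w = q
    · subst hwq
      obtain rfl := P₂.eq_singleton
      have hmax' : IsCycleMaximal G (insert w (insert x S₁)) := by
        have : insert w (insert x S₁) = insert x (S₁ ∪ {w}) := by grind
        rwa [this]
      have hxd := hmax'.adj hheavy (.cons hxp P₁ (by grind)) (by grind) (by grind)
        hxq.symm hdw.symm (by grind) huw.symm
      exact hcontra _ d (.cons (hle hxu) (.cons (hle huw) (.cons (hle hpw.symm) (P₁.mono hle)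
        (by grind)) (by grind)) (by grind)) hxd.symm (by grind) (by grind)
    · obtain ⟨e, S₃, hwe, P₃, hwS₃, rfl⟩ := P₂.uncons hwq
      have h3 := P₃.left_mem
      have hmax' : IsCycleMaximal G (insert w (S₃ ∪ insert x S₁)) := by
        have : insert w (S₃ ∪ insert x S₁) = insert x (S₁ ∪ insert w S₃) := by grind
        rwa [this]
      have hed := hmax'.adj hheavy (P₃.append hxq.symm (.cons hxp P₁ (by grind)) (by grind))
        (by grind) (by grind) hwe hdw.symm (by grind) huw.symm
      exact hcontra _ q (.cons (hle hxu) (.cons (hle huw) (.cons (hle hpw.symm)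
        ((P₁.mono hle).append hed.symm (P₃.mono hle) (by grind))
        (by grind)) (by grind)) (by grind)) (hle hxq.symm) (by grind) (by grind)
  · exact hcontra _ q (.cons (hle hxu) (.cons (hle huw) (.cons (hle hpw.symm) (P.mono hle) hwT)
      (by grind)) (by grind)) (hle hxq.symm) (by grind) (by grind)

lemma IsCycleMaximal.eq_univ (hmax : IsCycleMaximal G S) (h2 : TwoConnected G)
    (hheavy : TwoHeavy G) (h : ∀ u v : V, G.dist u v = 2 → FanOrShi G u v)
    (hS : CycleOn G S) (hlight : ∀ u ∉ S, ¬ Heavy G u) : S = Finset.univ := by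
  by_contra hne
  have hle := le_heavyCompletion (G := G)
  have hcard := hS.1
  obtain ⟨x₁, x₂, u₁, u₂, T, hx₁, hx₂, hx, hux₁, hux₂, Q, hT⟩ :=
    h2.exists_pathOn_compl (by omega) hne
  have hu₁ := hT _ Q.left_mem
  have hu₂ := hT _ Q.right_mem
  have hcontra : ∀ R b, PathOn (heavyCompletion G) x₁ b R → (heavyCompletion G).Adj b x₁ →
      u₁ ∈ R → S ⊆ R → False := fun R b P hbx huR hSR =>
    hu₁ (hmax R hSR ⟨hcard.trans (Finset.card_le_card hSR), x₁, b, P, hbx⟩ huR)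
  have hu₁Q := Q.left_mem
  obtain ⟨p, q, T₁, P, hxp, hxq, hpq, hxT₁, rfl⟩ := hS.exists_path_erase hx₁
  by_cases hxp₂ : x₂ = p
  · subst hxp₂
    exact hcontra _ q (.cons (hle hux₁.symm) ((Q.mono hle).append (hle hux₂) (P.mono hle)
      (by grind)) (by grind)) (hle hxq.symm) (by grind) (by grind)
  obtain ⟨S₁, S₂, d, P₁, hdx, P₂, hd, rfl⟩ := P.split (by grind) hxp₂
  have h1 := P₁.right_mem
  have h3 := P₂.right_mem
  have hdq : (heavyCompletion G).Adj d q := by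
    by_cases hxq₂ : x₂ = q
    · exact hxq₂ ▸ hle hdx
    · obtain ⟨e, S₃, hxe, P₃, hxS₃, rfl⟩ := P₂.uncons hxq₂
      have hmax' : IsCycleMaximal G (insert x₂ (insert x₁ S₁ ∪ S₃)) := by
        have : insert x₂ (insert x₁ S₁ ∪ S₃) = insert x₁ (S₁ ∪ insert x₂ S₃) := by grind
        rwa [this]
      have hq := hmax.heavy hheavy h P.symm hxT₁ (by grind) hxq hxp hux₁.symm (hlight _ hu₁)
      have hd' := hmax'.heavy hheavy h
        (((PathOn.cons hxp P₁ (by grind)).symm).append hxq P₃.symm (by grind))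
        (by grind) (by grind) hdx.symm hxe hux₂.symm (hlight _ hu₂)
      exact ⟨by grind, Or.inr ⟨hd', hq⟩⟩
  exact hcontra _ u₁ (((PathOn.cons hxp P₁ (by grind)).mono hle).append hdq
    ((P₂.symm.append hux₂.symm Q.symm (by grind)).mono hle) (by grind)) (hle hux₁)
    (by grind) (by grind)

lemma TwoConnected.exists_cycleOn_heavy (h : TwoConnected G) :
    ∃ S, (∀ u, Heavy G u → u ∈ S) ∧ CycleOn (heavyCompletion G) S := by
  classical
  have hle := le_heavyCompletion (G := G)
  set K := Finset.univ.filter (Heavy G) with hK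
  have hclique : ∀ a ∈ K, ∀ b ∈ K, a ≠ b → (heavyCompletion G).Adj a b :=
    fun a ha b hb hab => ⟨hab, Or.inr ⟨by simpa [hK] using ha, by simpa [hK] using hb⟩⟩
  by_cases hcard : 3 ≤ K.card
  · obtain ⟨a, ha⟩ := Finset.card_pos.mp (by omega : 0 < K.card)
    obtain ⟨b, P⟩ := PathOn.exists_of_isClique hclique ha
    refine ⟨K, by simp [hK], hcard, a, b, P, hclique _ P.right_mem _ ha ?_⟩
    rintro rfl
    rw [P.eq_singleton] at hcard
    simp at hcard
  obtain ⟨a, b, hab, hsub⟩ : ∃ a b, (heavyCompletion G).Adj a b ∧ K ⊆ {a, b} := by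
    by_cases hcard' : K.card ≤ 1
    · obtain ⟨v⟩ : Nonempty V := Fintype.card_pos_iff.mp (by have := h.1; omega)
      obtain ⟨a, ha⟩ : ∃ a, K ⊆ {a} := by
        have : Nonempty V := ⟨v⟩
        exact Finset.card_le_one_iff_subset_singleton.mp hcard'
      have : Nontrivial V := Fintype.one_lt_card_iff_nontrivial.mp (by have := h.1; omega)
      obtain ⟨c, hc⟩ := exists_ne a
      obtain ⟨b, hab, -⟩ := h.exists_adj_ne_s4 hc.symm
      exact ⟨a, b, hle hab, by grind⟩
    · obtain ⟨a, b, hab, hKab⟩ := Finset.card_eq_two.mp (by omega : K.card = 2)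
      exact ⟨a, b, hclique a (by grind) b (by grind) hab, hKab.le⟩
  obtain ⟨S, ha, hb, hS⟩ := h.exists_cycleOn hle hab
  refine ⟨S, fun u hu => ?_, hS⟩
  have := hsub (show u ∈ K by simpa [hK] using hu)
  grind

end HeavyCompletion

/-- **Broersma–Ryjáček–Schiermeyer theorem.** A 2-connected 2-heavy graph in
which every pair of vertices at distance 2 satisfies Fan's or Shi's condition
is Hamiltonian. -/
theorem brs_two_heavy {V : Type*} [Fintype V] [DecidableEq V]
    (G : SimpleGraph V) [DecidableRel G.Adj]
    (h2 : TwoConnected G)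
    (hheavy : TwoHeavy G)
    (h : ∀ u v : V, G.dist u v = 2 → FanOrShi G u v) :
    G.IsHamiltonian := by
  obtain ⟨S₀, hK, hS₀⟩ := h2.exists_cycleOn_heavy
  obtain ⟨S, hle, hS⟩ := (Set.toFinite {S | CycleOn (heavyCompletion G) S}).exists_le_maximal hS₀
  obtain ⟨T, hST, hT⟩ := hS.prop.exists_of_degree_add le_heavyCompletion (fun u v huv hG => by
    have h1 := huv.2.resolve_left hG
    unfold Heavy at h1
    omega)
  obtain rfl : S = T :=
    hST.antisymm (hS.le_of_ge (hT.mono le_heavyCompletion) hST)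
  have hmax : IsCycleMaximal G S := fun T hST hT => hS.le_of_ge hT hST
  have := hmax.eq_univ h2 hheavy h hT (fun u hu hu' => hu (hle (hK u hu')))
  exact (this ▸ hT).isHamiltonian
end
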